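/- For every simplicial group G, the formula g · (h_n, h_{n-1}, ..., h_0) = (g·h_n, (d_0 g)·h_{n-1}, (d_0^2 g)·h_{n-2}, ..., (d_0^n g)·h_0), i.e. left multiplication by ι_G(g), defines a free left action of G_n on (W_gr G)_n for each n, compatible with the simplicial structure, and the isomorphism Φ : WG → W_gr G is G-equivariant for this action and the action of G on WG by left multiplication on the first factor. -/

import Mathlib

universe u

/-- The data of a simplicial group: a group `X n` for each `n`, with face maps
`d n i : X (n+1) → X n` (meaningful for `i ≤ n+1`) and degeneracy maps
`s n i : X n → X (n+1)` (meaningful for `i ≤ n`). -/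
structure SGrpData where
  X : ℕ → Type u
  grp : ∀ n, Group (X n)
  d : ∀ n, ℕ → X (n+1) → X n
  s : ∀ n, ℕ → X n → X (n+1)

attribute [instance] SGrpData.grp

/-- A simplicial group: the data satisfies the simplicial identities and all face and
degeneracy maps are group homomorphisms. -/
structure SGrp extends SGrpData where
  d_mul : ∀ n i (x y : X (n+1)), d n i (x * y) = d n i x * d n i y
  s_mul : ∀ n i (x y : X n), s n i (x * y) = s n i x * s n i y
  d_d : ∀ n i j, i < j → j ≤ n + 2 → ∀ x : X (n+2),
    d n i (d (n+1) j x) = d n (j-1) (d (n+1) i x)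
  s_s : ∀ n i j, i ≤ j → j ≤ n → ∀ x : X n,
    s (n+1) i (s n j x) = s (n+1) (j+1) (s n i x)
  d_s_lt : ∀ n i j, i < j → j ≤ n + 1 → ∀ x : X (n+1),
    d (n+1) i (s (n+1) j x) = s n (j-1) (d n i x)
  d_s_self : ∀ n j, j ≤ n → ∀ x : X n, d n j (s n j x) = x
  d_s_succ : ∀ n j, j ≤ n → ∀ x : X n, d n (j+1) (s n j x) = x
  d_s_gt : ∀ n i j, j + 1 < i → i ≤ n + 2 → ∀ x : X (n+1),
    d (n+1) i (s (n+1) j x) = s n j (d n (i-1) x)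

/-- The underlying family of the W-construction: `WObj G n = G_n × G_{n-1} × ⋯ × G_0`. -/
def WObj (G : SGrpData.{u}) : ℕ → Type u
  | 0 => G.X 0
  | n+1 => G.X (n+1) × WObj G n

/-- Componentwise group structure on `WObj G n`. -/
instance WGroup (G : SGrpData.{u}) : ∀ n, Group (WObj G n)
  | 0 => G.grp 0
  | n+1 => @Prod.instGroup _ _ (G.grp (n+1)) (WGroup G n)

/-- Face maps of `W_gr G`:
`d_0(g_n,…,g_0) = (g_{n-1},…,g_0)` and
`d_i(g_n,…,g_0) = (d_i g_n, …, d_1 g_{n-i+1}, g_{n-i-1}, …, g_0)` for `i > 0`. -/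
def Wd (G : SGrpData.{u}) : ∀ n, ℕ → WObj G (n+1) → WObj G n
  | _, 0, x => x.2
  | 0, i+1, x => G.d 0 (i+1) x.1
  | n+1, i+1, x => (G.d (n+1) (i+1) x.1, Wd G n i x.2)

/-- Degeneracy maps of `W_gr G`:
`s_i(g_n,…,g_0) = (s_i g_n, …, s_0 g_{n-i}, g_{n-i}, g_{n-i-1}, …, g_0)`. -/
def Ws (G : SGrpData.{u}) : ∀ n, ℕ → WObj G n → WObj G (n+1)
  | 0, _, x => (G.s 0 0 x, x)
  | n+1, 0, x => (G.s (n+1) 0 x.1, x)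
  | n+1, i+1, x => (G.s (n+1) (i+1) x.1, Ws G n i x.2)

/-- The simplicial-group data of `W_gr G`. -/
def WgrData (G : SGrpData.{u}) : SGrpData.{u} where
  X := WObj G
  grp := WGroup G
  d := Wd G
  s := Ws G
/-- Levelwise (componentwise) application of a family of maps to the W-construction;
this is both `W f` and `W_gr f` on morphisms. -/
def Wmap (G H : SGrpData.{u}) (f : ∀ n, G.X n → H.X n) : ∀ n, WObj G n → WObj H n
  | 0, x => f 0 x
  | n+1, x => (f (n+1) x.1, Wmap G H f n x.2)

/-- First-factor projection `(W_gr G)_n = G_n × ⋯ × G_0 → G_n`. -/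
def Wfst (G : SGrpData.{u}) : ∀ n, WObj G n → G.X n
  | 0, x => x
  | _+1, x => x.1

/-- The unit `ι_G : G → W_gr G`, `g ↦ (g, d_0 g, d_0² g, …, d_0ⁿ g)`. -/
def Wiota (G : SGrpData.{u}) : ∀ n, G.X n → WObj G n
  | 0, g => g
  | n+1, g => (g, Wiota G n (G.d n 0 g))

/-- The multiplication `μ_G : W_gr (W_gr G) → W_gr G`, levelwise the product of
the first-factor projections. -/
def Wmu (G : SGrpData.{u}) : ∀ n, WObj (WgrData G) n → WObj G n :=
  Wmap (WgrData G) G (fun n => Wfst G n)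

/-- Multiplication on the first factor: `a • (g_n, …, g_0) = (a·g_n, g_{n-1}, …, g_0)`.
This is the `G`-action on the classical `WG`. -/
def mulFst (G : SGrpData.{u}) : ∀ n, G.X n → WObj G n → WObj G n
  | 0, a, x => @HMul.hMul (G.X 0) (G.X 0) (G.X 0) _ a x
  | _+1, a, x => (a * x.1, x.2)

/-- Face maps of the classical universal bundle `WG`:
`d_0(g_n,…,g_0) = (d_0(g_n)·g_{n-1}, g_{n-2},…,g_0)` and for `i > 0`
`d_i(g_n,…,g_0) = (d_i g_n, …, d_1 g_{n-i+1}, d_0(g_{n-i})·g_{n-i-1}, g_{n-i-2},…,g_0)`. -/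
def WBd (G : SGrpData.{u}) : ∀ n, ℕ → WObj G (n+1) → WObj G n
  | n, 0, x => mulFst G n (G.d n 0 x.1) x.2
  | 0, i+1, x => G.d 0 (i+1) x.1
  | n+1, i+1, x => (G.d (n+1) (i+1) x.1, WBd G n i x.2)

/-- Degeneracy maps of the classical `WG`:
`s_i(g_n,…,g_0) = (s_i g_n, …, s_0 g_{n-i}, 1, g_{n-i-1},…,g_0)`. -/
def WBs (G : SGrpData.{u}) : ∀ n, ℕ → WObj G n → WObj G (n+1)
  | 0, _, x => (G.s 0 0 x, 1)
  | n+1, 0, x => (G.s (n+1) 0 x.1, ((1 : G.X (n+1)), x.2))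
  | n+1, i+1, x => (G.s (n+1) (i+1) x.1, WBs G n i x.2)

/-- The standard inclusion `G → WG`, `g ↦ (g, 1, …, 1)`. -/
def WBiota (G : SGrpData.{u}) : ∀ n, G.X n → WObj G n
  | 0, g => g
  | n+1, g => (g, (1 : WObj G n))

/-- `Φ : WG → W_gr G`, `(g_n, …, g_0) ↦ (k_n, …, k_0)` with `k_n = g_n` and
`k_{j-1} = d_0(k_j)·g_{j-1}`. -/
def Phi (G : SGrpData.{u}) : ∀ n, WObj G n → WObj G n
  | 0, x => x
  | n+1, x => (x.1, Phi G n (mulFst G n (G.d n 0 x.1) x.2))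

/-- `Φ⁻¹ : W_gr G → WG`, `(h_n, …, h_0) ↦ (h_n, d_0(h_n)⁻¹·h_{n-1}, …, d_0(h_1)⁻¹·h_0)`. -/
def PhiInv (G : SGrpData.{u}) : ∀ n, WObj G n → WObj G n
  | 0, x => x
  | n+1, x => (x.1, mulFst G n (G.d n 0 x.1)⁻¹ (PhiInv G n x.2))

/-- `f` is a morphism of simplicial groups `G → H`: levelwise a group homomorphism,
commuting with all face and degeneracy maps. -/
def IsSMor (G H : SGrpData.{u}) (f : ∀ n, G.X n → H.X n) : Prop :=
  (∀ n (x y : G.X n), f n (x * y) = f n x * f n y) ∧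
  (∀ n i, i ≤ n + 1 → ∀ x : G.X (n+1), f n (G.d n i x) = H.d n i (f (n+1) x)) ∧
  (∀ n i, i ≤ n → ∀ x : G.X n, f (n+1) (G.s n i x) = H.s n i (f n x))

theorem SGrp.d_one (G : SGrp.{u}) (n i : ℕ) : G.d n i 1 = 1 :=
  map_one (MonoidHom.mk' (G.d n i) (G.d_mul n i))

theorem Wiota_one (G : SGrp.{u}) : ∀ n, Wiota G.toSGrpData n 1 = 1
  | 0 => rfl
  | n+1 => Prod.ext rfl ((congrArg _ (G.d_one n 0)).trans (Wiota_one G n))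

theorem Wiota_mul (G : SGrp.{u}) : ∀ n (g h : G.X n),
    Wiota G.toSGrpData n (g * h) = Wiota G.toSGrpData n g * Wiota G.toSGrpData n h
  | 0, _, _ => rfl
  | n+1, g, h => Prod.ext rfl ((congrArg _ (G.d_mul n 0 g h)).trans (Wiota_mul G n _ _))

theorem Wiota_injective (G : SGrpData.{u}) : ∀ n, Function.Injective (Wiota G n)
  | 0 => fun _ _ h => h
  | _+1 => fun _ _ h => congrArg Prod.fst h

theorem Wd_mul (G : SGrp.{u}) : ∀ n i (x y : WObj G.toSGrpData (n+1)),
    Wd G.toSGrpData n i (x * y) = Wd G.toSGrpData n i x * Wd G.toSGrpData n i y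
  | 0, 0, _, _ => rfl
  | _+1, 0, _, _ => rfl
  | 0, i+1, x, y => G.d_mul 0 (i+1) x.1 y.1
  | n+1, i+1, x, y => Prod.ext (G.d_mul (n+1) (i+1) x.1 y.1) (Wd_mul G n i x.2 y.2)

theorem Ws_mul (G : SGrp.{u}) : ∀ n i (x y : WObj G.toSGrpData n),
    Ws G.toSGrpData n i (x * y) = Ws G.toSGrpData n i x * Ws G.toSGrpData n i y
  | 0, _, x, y => Prod.ext (G.s_mul 0 0 x y) rfl
  | n+1, 0, x, y => Prod.ext (G.s_mul (n+1) 0 x.1 y.1) rfl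
  | n+1, i+1, x, y => Prod.ext (G.s_mul (n+1) (i+1) x.1 y.1) (Ws_mul G n i x.2 y.2)

theorem Wd_Wiota (G : SGrp.{u}) : ∀ n i, i ≤ n + 1 → ∀ g : G.X (n+1),
    Wd G.toSGrpData n i (Wiota G.toSGrpData (n+1) g) = Wiota G.toSGrpData n (G.d n i g)
  | 0, 0, _, _ => rfl
  | _+1, 0, _, _ => rfl
  | 0, _+1, _, _ => rfl
  | n+1, i+1, hi, g => Prod.ext rfl <|
      (Wd_Wiota G n i (by lia) (G.d (n+1) 0 g)).trans
        (congrArg _ (G.d_d n 0 (i+1) i.succ_pos hi g).symm)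

theorem Ws_Wiota (G : SGrp.{u}) : ∀ n i, i ≤ n → ∀ g : G.X n,
    Ws G.toSGrpData n i (Wiota G.toSGrpData n g) = Wiota G.toSGrpData (n+1) (G.s n i g)
  | 0, 0, _, g => Prod.ext rfl (G.d_s_self 0 0 le_rfl g).symm
  | n+1, 0, hi, g => Prod.ext rfl <|
      congrArg (Wiota G.toSGrpData (n+1)) (G.d_s_self (n+1) 0 hi g).symm
  | n+1, i+1, hi, g => Prod.ext rfl <|
      (Ws_Wiota G n i (by lia) (G.d n 0 g)).trans
        (congrArg _ (G.d_s_lt n 0 (i+1) i.succ_pos hi g).symm)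

theorem mulFst_mul (G : SGrpData.{u}) : ∀ n (g h : G.X n) (x : WObj G n),
    mulFst G n (g * h) x = mulFst G n g (mulFst G n h x)
  | 0, g, h, x => (G.grp 0).mul_assoc g h x
  | _+1, g, h, x => Prod.ext (mul_assoc g h x.1) rfl

theorem Phi_mulFst (G : SGrp.{u}) : ∀ n (g : G.X n) (x : WObj G.toSGrpData n),
    Phi G.toSGrpData n (mulFst G.toSGrpData n g x) =
      Wiota G.toSGrpData n g * Phi G.toSGrpData n x
  | 0, _, _ => rfl
  | n+1, g, x => by
    refine Prod.ext rfl ?_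
    change Phi G.toSGrpData n (mulFst G.toSGrpData n (G.d n 0 (g * x.1)) x.2) =
      Wiota G.toSGrpData n (G.d n 0 g) *
        Phi G.toSGrpData n (mulFst G.toSGrpData n (G.d n 0 x.1) x.2)
    rw [G.d_mul, mulFst_mul, Phi_mulFst G n]

/-- For every simplicial group `G`, left multiplication by `ι_G(g)`, i.e.
`g • (h_n,…,h_0) = (g·h_n, (d_0 g)·h_{n-1}, …, (d_0ⁿ g)·h_0)`, defines a free left action of
`G_n` on `(W_gr G)_n` for each `n`, compatible with the simplicial structure, and
`Φ : WG → W_gr G` is `G`-equivariant for this action and the action of `G` on `WG` by left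
multiplication on the first factor. -/
theorem Wgr_free_action_equivariant (G : SGrp.{u}) :
    -- the action is left multiplication by `ι_G(g)` and is given by the stated formula
    (∀ n (g : G.X (n+1)) (x : WObj G.toSGrpData (n+1)),
      Wiota G.toSGrpData (n+1) g * x =
        (g * x.1, Wiota G.toSGrpData n (G.d n 0 g) * x.2)) ∧
    -- it is a left action
    (∀ n (x : WObj G.toSGrpData n), Wiota G.toSGrpData n 1 * x = x) ∧
    (∀ n (g h : G.X n) (x : WObj G.toSGrpData n),
      Wiota G.toSGrpData n (g * h) * x =
        Wiota G.toSGrpData n g * (Wiota G.toSGrpData n h * x)) ∧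
    -- the action is free
    (∀ n (g h : G.X n) (x : WObj G.toSGrpData n),
      Wiota G.toSGrpData n g * x = Wiota G.toSGrpData n h * x → g = h) ∧
    -- compatibility with the simplicial structure
    (∀ n i, i ≤ n + 1 → ∀ (g : G.X (n+1)) (x : WObj G.toSGrpData (n+1)),
      Wd G.toSGrpData n i (Wiota G.toSGrpData (n+1) g * x) =
        Wiota G.toSGrpData n (G.d n i g) * Wd G.toSGrpData n i x) ∧
    (∀ n i, i ≤ n → ∀ (g : G.X n) (x : WObj G.toSGrpData n),
      Ws G.toSGrpData n i (Wiota G.toSGrpData n g * x) =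
        Wiota G.toSGrpData (n+1) (G.s n i g) * Ws G.toSGrpData n i x) ∧
    -- `Φ` is `G`-equivariant (the action on `WG` is multiplication on the first factor)
    (∀ n (g : G.X n) (x : WObj G.toSGrpData n),
      Phi G.toSGrpData n (mulFst G.toSGrpData n g x) =
        Wiota G.toSGrpData n g * Phi G.toSGrpData n x) := by
  refine ⟨fun _ _ _ => rfl, fun n x => ?_, fun n g h x => ?_, fun n g h x e => ?_,
    fun n i hi g x => ?_, fun n i hi g x => ?_, Phi_mulFst G⟩
  · rw [Wiota_one, one_mul]
  · rw [Wiota_mul, mul_assoc]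
  · exact Wiota_injective _ n (mul_right_cancel e)
  · rw [Wd_mul, Wd_Wiota G n i hi]
  · rw [Ws_mul, Ws_Wiota G n i hi]
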